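/- arXiv:math/0510276 — 2 statements merged into one kernel-verified Lean document; each statement's English description precedes it below -/
import Mathlib

section
/- Every CAR mechanism on a finite nonempty set E is a finite convex combination of extreme CAR mechanisms on E; that is, for every CAR mechanism π there exist finitely many extreme CAR mechanisms π₁,…,π_p and nonnegative weights λ₁,…,λ_p summing to 1 such that π = λ₁π₁ + … + λ_pπ_p. -/
/-- A CAR (Coarsening At Random) mechanism on a finite nonempty set `E`:
a function `π` from subsets of `E` to the reals, vanishing on `∅` (so that it is
effectively a function on the nonempty subsets), nonnegative, and such that
for every `x ∈ E` the sum of `π A` over all subsets `A` containing `x` equals `1`. -/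
def IsCAR {E : Type*} [Fintype E] [DecidableEq E] (π : Finset E → ℝ) : Prop :=
  π ∅ = 0 ∧ (∀ A : Finset E, 0 ≤ π A) ∧
    ∀ x : E, ∑ A ∈ Finset.univ.filter (fun A : Finset E => x ∈ A), π A = 1

/-- The support of a coarsening mechanism: the collection of subsets with positive mass. -/
def carSupport {E : Type*} (π : Finset E → ℝ) : Set (Finset E) := {A | 0 < π A}

/-- An extreme CAR mechanism: a CAR mechanism that is the unique CAR mechanism
with its support. -/
def IsExtremeCAR {E : Type*} [Fintype E] [DecidableEq E] (π : Finset E → ℝ) : Prop :=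
  IsCAR π ∧
    ∀ π' : Finset E → ℝ, IsCAR π' → carSupport π' = carSupport π → π' = π

section CAR

variable {E : Type*} [Fintype E] [DecidableEq E]

/-- A nonzero direction preserving the linear CAR constraints takes a negative value. -/
lemma exists_neg_of_sum_eq_zero {d : Finset E → ℝ} (h0 : d ∅ = 0)
    (hs : ∀ x : E, ∑ A ∈ Finset.univ.filter (fun A : Finset E => x ∈ A), d A = 0)
    (hd : d ≠ 0) : ∃ A, d A < 0 := by
  by_contra! h
  refine hd (funext fun A => ?_)
  rcases A.eq_empty_or_nonempty with rfl | ⟨x, hx⟩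
  · exact h0
  · exact (Finset.sum_eq_zero_iff_of_nonneg fun B _ => h B).1 (hs x) A (by simpa using hx)

/-- From a CAR mechanism one can move along a nonzero direction supported in its support
until the support strictly shrinks. -/
lemma IsCAR.exists_add_smul_support_ssubset {π d : Finset E → ℝ} (hπ : IsCAR π)
    (h0 : d ∅ = 0)
    (hs : ∀ x : E, ∑ A ∈ Finset.univ.filter (fun A : Finset E => x ∈ A), d A = 0)
    (hd : d ≠ 0) (hsupp : ∀ A, π A = 0 → d A = 0) :
    ∃ t : ℝ, 0 < t ∧ IsCAR (π + t • d) ∧ carSupport (π + t • d) ⊂ carSupport π := by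
  obtain ⟨A₀, hA₀⟩ := exists_neg_of_sum_eq_zero h0 hs hd
  obtain ⟨B, hB, hmin⟩ := Finset.exists_min_image
    (Finset.univ.filter fun A => d A < 0) (fun A => π A / -d A) ⟨A₀, by simpa using hA₀⟩
  replace hB : d B < 0 := by simpa using hB
  have hpos : ∀ A, d A ≠ 0 → 0 < π A := fun A hA =>
    (hπ.2.1 A).lt_of_ne' fun h => hA (hsupp A h)
  have ht : 0 < π B / -d B := div_pos (hpos B hB.ne) (neg_pos.2 hB)
  refine ⟨π B / -d B, ht, ⟨?_, fun A => ?_, fun x => ?_⟩, ?_⟩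
  · simp [h0, hπ.1]
  · simp only [Pi.add_apply, Pi.smul_apply, smul_eq_mul]
    rcases lt_or_ge (d A) 0 with hA | hA
    · have := (le_div_iff₀ (neg_pos.2 hA)).1 (hmin A (by simpa using hA))
      linarith
    · exact add_nonneg (hπ.2.1 A) (mul_nonneg ht.le hA)
  · simp only [Pi.add_apply, Pi.smul_apply, smul_eq_mul, Finset.sum_add_distrib,
      ← Finset.mul_sum, hs x, hπ.2.2 x, mul_zero, add_zero]
  · refine (Set.ssubset_iff_of_subset fun A hA => ?_).2 ⟨B, hpos B hB.ne, ?_⟩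
    · by_contra hn
      have hA0 : π A = 0 := le_antisymm (not_lt.1 hn) (hπ.2.1 A)
      simp [carSupport, hA0, hsupp A hA0] at hA
    · have hB0 : π B + π B / -d B * d B = 0 := by
        field_simp [hB.ne]
        ring
      simp [carSupport, hB0]

lemma IsCAR.mem_convexHull {π : Finset E → ℝ} (hπ : IsCAR π) :
    π ∈ convexHull ℝ {ρ : Finset E → ℝ | IsExtremeCAR ρ} := by
  induction hn : (carSupport π).ncard using Nat.strong_induction_on generalizing π with
  | _ n ih =>
  subst hn
  by_cases hext : IsExtremeCAR π
  · exact subset_convexHull ℝ _ hext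
  obtain ⟨π', hπ', hsupp, hne⟩ :
      ∃ π', IsCAR π' ∧ carSupport π' = carSupport π ∧ π' ≠ π := by
    by_contra! h
    exact hext ⟨hπ, h⟩
  have hzero : ∀ A, π A = 0 → π' A = 0 := fun A hA => by
    have h : ¬ 0 < π' A := fun h' => by
      have : A ∈ carSupport π := hsupp ▸ h'
      exact absurd hA (ne_of_gt this)
    exact le_antisymm (not_lt.1 h) (hπ'.2.1 A)
  obtain ⟨t, ht, hcar, hlt⟩ := hπ.exists_add_smul_support_ssubset (d := π' - π)
    (by simp [hπ.1, hπ'.1]) (fun x => by simp [hπ.2.2 x, hπ'.2.2 x])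
    (sub_ne_zero.2 hne) (fun A hA => by simp [hA, hzero A hA])
  obtain ⟨s, hs, hcar', hlt'⟩ := hπ.exists_add_smul_support_ssubset (d := π - π')
    (by simp [hπ.1, hπ'.1]) (fun x => by simp [hπ.2.2 x, hπ'.2.2 x])
    (sub_ne_zero.2 hne.symm) (fun A hA => by simp [hA, hzero A hA])
  have h₁ := ih _ (Set.ncard_lt_ncard hlt (Set.toFinite _)) hcar rfl
  have h₂ := ih _ (Set.ncard_lt_ncard hlt' (Set.toFinite _)) hcar' rfl
  have hst : s + t ≠ 0 := (add_pos hs ht).ne'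
  convert (convex_convexHull ℝ _) h₁ h₂ (a := s / (s + t)) (b := t / (s + t))
    (by positivity) (by positivity) (by field_simp) using 1
  ext A
  simp only [Pi.add_apply, Pi.smul_apply, Pi.sub_apply, smul_eq_mul]
  field_simp
  ring

end CAR

/-- Every CAR mechanism is a finite convex combination of extreme CAR mechanisms. -/
theorem car_is_mixture_of_extreme {E : Type*} [Fintype E] [DecidableEq E] [Nonempty E]
    (π : Finset E → ℝ) (hπ : IsCAR π) :
    ∃ (p : ℕ) (πs : Fin p → Finset E → ℝ) (lam : Fin p → ℝ),
      (∀ i, IsExtremeCAR (πs i)) ∧ (∀ i, 0 ≤ lam i) ∧ (∑ i, lam i = 1) ∧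
      ∀ A : Finset E, π A = ∑ i, lam i * πs i A := by
  obtain ⟨ι, _, w, z, hw, hw1, hz, hsum⟩ := mem_convexHull_iff_exists_fintype.1 hπ.mem_convexHull
  let e := (Fintype.equivFin ι).symm
  refine ⟨Fintype.card ι, z ∘ e, w ∘ e, fun i => hz (e i), fun i => hw (e i), ?_, fun A => ?_⟩
  · rw [← hw1]
    exact e.sum_comp w
  · rw [← hsum, Finset.sum_apply]
    exact (e.sum_comp fun i => w i * z i A).symm
end

section
/- For every odd n > 0, the linear system S_n z = 1 (where 1 is the all-ones vector in ℝⁿ) has a unique solution, and this solution is z = (F_{n-1}/F_n, F_{n-2}/F_n, …, F_2/F_n, F_1/F_n, 1/F_n), where F_j denotes the j-th Fibonacci number. -/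
/-- The matrices `S_n` of Theorem 3 (Gill–Grünwald), defined inductively:
`S_1 = (1)`; for odd `m`, `S_{m+1}` has `1` in the top-left corner, zero row vector to
its right, zero column vector below it, and `S_m` in the bottom-right block; for even `m`,
`S_{m+1}` has `0` in the top-left corner, all-ones row and column borders, and `S_m` in the
bottom-right block. -/
def Smat : (n : ℕ) → Matrix (Fin n) (Fin n) ℝ
  | 0 => 0
  | 1 => Matrix.of fun _ _ => 1
  | (m + 2) =>
    -- here `S_{m+2}` is built from `S_{m+1}`; the corner entry is `1` if `m+1` is odd,
    -- `0` if `m+1` is even, and the borders are the complementary constant.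
    Matrix.of
      (Fin.cases
        (Fin.cases (if Odd (m + 1) then (1 : ℝ) else 0)
          (fun _ => if Odd (m + 1) then (0 : ℝ) else 1))
        (fun i => Fin.cases (if Odd (m + 1) then (0 : ℝ) else 1)
          (fun j => Smat (m + 1) i j)))

/-- The candidate solution `z = (F_{n-1}/F_n, F_{n-2}/F_n, …, F_1/F_n, 1/F_n)`,
where `F` is the Fibonacci sequence (`Nat.fib`, with `F_1 = F_2 = 1`). -/
noncomputable def zsol (n : ℕ) : Fin n → ℝ := fun i =>
  if (i : ℕ) = n - 1 then 1 / (Nat.fib n : ℝ)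
  else (Nat.fib (n - 1 - (i : ℕ)) : ℝ) / (Nat.fib n : ℝ)

theorem zsol_add_two (m : ℕ) (hm : 0 < m) :
    zsol (m + 2) = Fin.cons ((Nat.fib (m + 1) : ℝ) / Nat.fib (m + 2))
      (Fin.cons ((Nat.fib m : ℝ) / Nat.fib (m + 2))
        (((Nat.fib m : ℝ) / Nat.fib (m + 2)) • zsol m)) := by
  have hf : (Nat.fib m : ℝ) ≠ 0 := by exact_mod_cast (Nat.fib_pos.2 hm).ne'
  ext i
  refine Fin.cases ?_ (fun i => Fin.cases ?_ (fun i => ?_) i) i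
  · simp [zsol]
  · simp [zsol, hm.ne']
  · have h : ((i : ℕ) + 1 + 1 = m + 2 - 1) ↔ ((i : ℕ) = m - 1) := by omega
    have h' : m + 2 - 1 - ((i : ℕ) + 1 + 1) = m - 1 - i := by omega
    simp only [zsol, Fin.cons_succ, Fin.val_succ, Pi.smul_apply, smul_eq_mul, h, h']
    split_ifs <;> field_simp

theorem sum_zsol (k : ℕ) :
    ∑ i, zsol (2 * k + 1) i = (Nat.fib (2 * k + 2) : ℝ) / Nat.fib (2 * k + 1) := by
  induction k with
  | zero => simp [zsol]
  | succ k ih =>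
    have hf : (Nat.fib (2 * k + 1) : ℝ) ≠ 0 := by
      exact_mod_cast (Nat.fib_pos.2 (Nat.succ_pos _)).ne'
    have e : (Nat.fib (2 * k + 3 + 1) : ℝ)
        = Nat.fib (2 * k + 2) + (Nat.fib (2 * k + 1) + Nat.fib (2 * k + 2)) := by
      rw [Nat.fib_add_two (n := 2 * k + 2), Nat.fib_add_two (n := 2 * k + 1)]
      push_cast
      ring
    change ∑ i, zsol (2 * k + 1 + 2) i = (Nat.fib (2 * k + 3 + 1) : ℝ) / Nat.fib (2 * k + 3)
    rw [zsol_add_two _ (Nat.succ_pos _), Fin.sum_univ_succ, Fin.sum_univ_succ, e]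
    simp only [Fin.cons_zero, Fin.cons_succ, Pi.smul_apply, smul_eq_mul, ← Finset.mul_sum, ih]
    field_simp

theorem smat_odd_add_two_mulVec (k : ℕ) (a b c : ℝ) (w : Fin (2 * k + 1) → ℝ) :
    ((Smat (2 * k + 1 + 2)).mulVec (Fin.cons a (Fin.cons b w)) = fun _ => c) ↔
      b + ∑ i, w i = c ∧ a + b = c ∧ (Smat (2 * k + 1)).mulVec w = fun _ => c - a := by
  have h1 : ¬ Odd (2 * k + 1 + 1) := by simp [parity_simps]
  have h2 : Odd (2 * k + 1) := ⟨k, rfl⟩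
  simp only [funext_iff, Fin.forall_fin_succ (n := 2 * k + 2),
    Fin.forall_fin_succ (n := 2 * k + 1), Matrix.mulVec, dotProduct,
    Fin.sum_univ_succ (n := 2 * k + 2), Fin.sum_univ_succ (n := 2 * k + 1),
    Fin.cons_zero, Fin.cons_succ]
  simp [Smat, h1, h2, eq_sub_iff_add_eq', -Fin.succ_zero_eq_one, -Fin.succ_zero_eq_one']

theorem smat_odd_mulVec_eq_const_iff (k : ℕ) (c : ℝ) (z : Fin (2 * k + 1) → ℝ) :
    ((Smat (2 * k + 1)).mulVec z = fun _ => c) ↔ z = c • zsol (2 * k + 1) := by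
  induction k generalizing c with
  | zero => simp [funext_iff, Matrix.mulVec, dotProduct, Smat, zsol]
  | succ k ih =>
    obtain ⟨a, z, rfl⟩ : ∃ a y, z = Fin.cons a y := ⟨_, _, (Fin.cons_self_tail z).symm⟩
    obtain ⟨b, w, rfl⟩ : ∃ b w, z = Fin.cons b w := ⟨_, _, (Fin.cons_self_tail z).symm⟩
    refine (smat_odd_add_two_mulVec k a b c w).trans ?_
    have hf : (0 : ℝ) < Nat.fib (2 * k + 1) := by
      exact_mod_cast Nat.fib_pos.2 (Nat.succ_pos _)
    have hg : (0 : ℝ) < Nat.fib (2 * k + 2) := by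
      exact_mod_cast Nat.fib_pos.2 (Nat.succ_pos _)
    have e : (Nat.fib (2 * k + 1 + 2) : ℝ) = Nat.fib (2 * k + 1) + Nat.fib (2 * k + 2) := by
      rw [Nat.fib_add_two]
      push_cast
      rfl
    have hz : (Fin.cons a (Fin.cons b w) = c • zsol (2 * k + 1 + 2)) ↔
        a = c * (Nat.fib (2 * k + 2) / Nat.fib (2 * k + 1 + 2)) ∧
        b = c * (Nat.fib (2 * k + 1) / Nat.fib (2 * k + 1 + 2)) ∧
        w = (c * (Nat.fib (2 * k + 1) / Nat.fib (2 * k + 1 + 2))) • zsol (2 * k + 1) := by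
      rw [zsol_add_two _ (Nat.succ_pos _)]
      simp [funext_iff, Fin.forall_fin_succ (n := 2 * k + 2),
        Fin.forall_fin_succ (n := 2 * k + 1), mul_assoc]
    refine Iff.trans ?_ hz.symm
    rw [ih, e]
    constructor
    · rintro ⟨h1, h2, rfl⟩
      have hb : b = c - a := by linarith
      simp only [Pi.smul_apply, smul_eq_mul, ← Finset.mul_sum, sum_zsol] at h1
      rw [← hb] at h1 ⊢
      have hb' : b = c * (Nat.fib (2 * k + 1) / (Nat.fib (2 * k + 1) + Nat.fib (2 * k + 2))) := by
        field_simp at h1 ⊢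
        linarith
      refine ⟨?_, hb', by rw [← hb']⟩
      have ha : a = c - b := by linarith
      rw [ha, hb']
      field_simp
      ring
    · rintro ⟨rfl, rfl, rfl⟩
      refine ⟨?_, ?_, ?_⟩
      · simp only [Pi.smul_apply, smul_eq_mul, ← Finset.mul_sum, sum_zsol]
        field_simp
      · field_simp
        ring
      · congr 1
        field_simp
        ring

/-- For every odd `n > 0`, the linear system `S_n z = 1` has the unique solution
`z = (F_{n-1}/F_n, …, F_1/F_n, 1/F_n)`. -/
theorem smat_unique_solution (n : ℕ) (hn : Odd n) (hpos : 0 < n) :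
    ∀ z : Fin n → ℝ, (Smat n).mulVec z = 1 ↔ z = zsol n := by
  obtain ⟨k, rfl⟩ := hn
  intro z
  have h := smat_odd_mulVec_eq_const_iff k 1 z
  rwa [one_smul] at h
end
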